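/- For every γ > 0, every x ∈ ℝ and every Borel set A ⊆ ℝ, ∫_A p(t; x, y) · 2 e^{-2γ|y|} dy → ∫_A γ e^{-2γ|y|} dy as t → ∞, where p(t; x, y) = (1/(2√(2πt))) exp( γ(|x| + |y|) − (γ²/2) t − (x − y)²/(2t) ) + (γ/4) Erfc( (|x| + |y| − γt)/√(2t) ). -/

import Mathlib

open MeasureTheory Real Set Filter

/-- The complementary error function `Erfc`. -/
noncomputable def erfc (x : ℝ) : ℝ :=
  (2 / Real.sqrt Real.pi) * ∫ u in Set.Ioi x, Real.exp (-u ^ 2)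

/-- The transition density `p(t; x, y)`, with respect to the speed measure
`m(dy) = 2 e^{-2γ|y|} dy`, of a Brownian motion with constant drift `γ` towards the origin. -/
noncomputable def transDensity (γ t x y : ℝ) : ℝ :=
  (1 / (2 * Real.sqrt (2 * Real.pi * t))) *
      Real.exp (γ * (|x| + |y|) - γ ^ 2 / 2 * t - (x - y) ^ 2 / (2 * t)) +
    (γ / 4) * erfc ((|x| + |y| - γ * t) / Real.sqrt (2 * t))

lemma aux_integrable : Integrable (fun u : ℝ => Real.exp (-u ^ 2)) := by
  simpa using integrable_exp_neg_mul_sq (b := 1) one_pos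

lemma aux_total : ∫ u : ℝ, Real.exp (-u ^ 2) = Real.sqrt Real.pi := by
  simpa using integral_gaussian 1

lemma aux_mul : (2 / Real.sqrt Real.pi) * Real.sqrt Real.pi = 2 := by
  have : Real.sqrt Real.pi ≠ 0 := by positivity
  field_simp

lemma erfc_nonneg (x : ℝ) : 0 ≤ erfc x := by
  unfold erfc
  exact mul_nonneg (by positivity) (integral_nonneg fun u => (Real.exp_pos _).le)

lemma erfc_le_two (x : ℝ) : erfc x ≤ 2 := by
  unfold erfc
  refine le_trans (mul_le_mul_of_nonneg_left ?_ (by positivity)) aux_mul.le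
  rw [← aux_total]
  exact setIntegral_le_integral aux_integrable (ae_of_all _ fun u => (Real.exp_pos _).le)

lemma erfc_antitone : Antitone erfc := by
  intro a b hab
  unfold erfc
  refine mul_le_mul_of_nonneg_left ?_ (by positivity)
  exact setIntegral_mono_set aux_integrable.integrableOn
    (ae_of_all _ fun u => (Real.exp_pos _).le) (Ioi_subset_Ioi hab).eventuallyLE

lemma erfc_tendsto : Tendsto erfc atBot (nhds 2) := by
  unfold erfc
  have h := (aecover_Ioi (μ := volume) (tendsto_id (α := ℝ) (x := atBot))).integral_tendsto_of_countably_generated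
    aux_integrable
  rw [aux_total] at h
  have h2 := h.const_mul (2 / Real.sqrt Real.pi)
  rw [aux_mul] at h2
  exact h2

lemma sqrt_two_tendsto : Tendsto (fun t : ℝ => Real.sqrt (2 * t)) atTop atTop :=
  Real.tendsto_sqrt_atTop.comp (tendsto_id.const_mul_atTop two_pos)

lemma arg_tendsto (γ c : ℝ) (hγ : 0 < γ) :
    Tendsto (fun t : ℝ => (c - γ * t) / Real.sqrt (2 * t)) atTop atBot := by
  have h1 : Tendsto (fun t : ℝ => c / Real.sqrt (2 * t)) atTop (nhds 0) :=
    sqrt_two_tendsto.const_div_atTop c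
  have h2 : Tendsto (fun t : ℝ => -(γ / 2) * Real.sqrt (2 * t)) atTop atBot :=
    sqrt_two_tendsto.const_mul_atTop_of_neg (by linarith)
  refine (h1.add_atBot h2).congr' ?_
  filter_upwards [eventually_gt_atTop 0] with t ht
  have hs : Real.sqrt (2 * t) ≠ 0 := by positivity
  have hq : Real.sqrt (2 * t) ^ 2 = 2 * t := Real.sq_sqrt (by positivity)
  rw [eq_div_iff hs, add_mul, div_mul_cancel₀ _ hs]
  linear_combination (-(γ / 2)) * hq

lemma coef_le_one (t : ℝ) (ht : 1 ≤ t) : 1 / (2 * Real.sqrt (2 * Real.pi * t)) ≤ 1 := by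
  have : 1 ≤ Real.sqrt (2 * Real.pi * t) := by
    rw [Real.one_le_sqrt]
    nlinarith [Real.pi_gt_three]
  rw [div_le_one (by positivity)]
  linarith

lemma first_le (γ x t y : ℝ) (ht : 1 ≤ t) :
    (1 / (2 * Real.sqrt (2 * Real.pi * t))) *
      Real.exp (γ * (|x| + |y|) - γ ^ 2 / 2 * t - (x - y) ^ 2 / (2 * t)) ≤
    Real.exp (γ * (|x| + |y|) - γ ^ 2 / 2 * t) := by
  have h0 : 0 ≤ (x - y) ^ 2 / (2 * t) := by positivity
  calc _ ≤ 1 * Real.exp (γ * (|x| + |y|) - γ ^ 2 / 2 * t - (x - y) ^ 2 / (2 * t)) :=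
        mul_le_mul_of_nonneg_right (coef_le_one t ht) (Real.exp_pos _).le
    _ ≤ _ := by
        rw [one_mul]
        exact Real.exp_le_exp.2 (by linarith)

lemma transDensity_tendsto (γ x y : ℝ) (hγ : 0 < γ) :
    Tendsto (fun t : ℝ => transDensity γ t x y) atTop (nhds (γ / 2)) := by
  unfold transDensity
  have h2 := ((erfc_tendsto.comp (arg_tendsto γ (|x| + |y|) hγ)).const_mul (γ / 4))
  have hb : Tendsto (fun t : ℝ => Real.exp (γ * (|x| + |y|) - γ ^ 2 / 2 * t)) atTop (nhds 0) := by
    refine Real.tendsto_exp_atBot.comp ?_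
    have : Tendsto (fun t : ℝ => -(γ ^ 2 / 2) * t) atTop atBot :=
      tendsto_id.const_mul_atTop_of_neg (by have := pow_pos hγ 2; linarith)
    refine (tendsto_atBot_add_const_left _ (γ * (|x| + |y|)) this).congr fun t => by ring
  have h1 := squeeze_zero' (g := fun t : ℝ => Real.exp (γ * (|x| + |y|) - γ ^ 2 / 2 * t))
    (f := fun t : ℝ => (1 / (2 * Real.sqrt (2 * Real.pi * t))) *
      Real.exp (γ * (|x| + |y|) - γ ^ 2 / 2 * t - (x - y) ^ 2 / (2 * t)))
    (t₀ := atTop)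
    (Eventually.of_forall fun t => by positivity)
    ((eventually_ge_atTop 1).mono fun t ht => first_le γ x t y ht) hb
  have h := h1.add h2
  rw [show 0 + γ / 4 * 2 = γ / 2 by ring] at h
  exact h

lemma transDensity_measurable (γ t x : ℝ) : Measurable (fun y => transDensity γ t x y) := by
  unfold transDensity
  have := erfc_antitone.measurable
  refine Measurable.add (by fun_prop) (Measurable.const_mul (this.comp ?_) _)
  exact (by fun_prop : Continuous fun y : ℝ => (|x| + |y| - γ * t) / Real.sqrt (2 * t)).measurable

lemma integrable_exp_abs (γ : ℝ) (hγ : 0 < γ) : Integrable (fun y : ℝ => Real.exp (-γ * |y|)) := by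
  have h1 : IntegrableOn (fun y : ℝ => Real.exp (-γ * |y|)) (Ioi 0) :=
    (exp_neg_integrableOn_Ioi 0 hγ).congr_fun
      (fun y hy => by simp only [abs_of_pos (mem_Ioi.1 hy)]) measurableSet_Ioi
  have h2 : IntegrableOn (fun y : ℝ => Real.exp (-γ * |y|)) (Iic 0) := by
    rw [integrableOn_Iic_iff_integrableOn_Iio]
    have := h1.comp_neg
    simpa using this
  rw [← integrableOn_univ, ← Iic_union_Ioi (a := (0 : ℝ))]
  exact h2.union h1

/-- Convergence of the time-`t` law from any starting point `x` to the stationary measure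
`π(dy) = γ e^{-2γ|y|} dy`. -/
theorem transDensity_tendsto_stationary (γ x : ℝ) (hγ : 0 < γ)
    (A : Set ℝ) (hA : MeasurableSet A) :
    Tendsto (fun t : ℝ =>
        ∫ y in A, transDensity γ t x y * (2 * Real.exp (-2 * γ * |y|)))
      atTop (nhds (∫ y in A, γ * Real.exp (-2 * γ * |y|))) := by
  refine tendsto_integral_filter_of_dominated_convergence
    (fun y => (2 * Real.exp (γ * |x|) + γ) * Real.exp (-γ * |y|)) ?_ ?_ ?_ ?_
  · refine Eventually.of_forall fun t => Measurable.aestronglyMeasurable ?_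
    exact (transDensity_measurable γ t x).mul (by fun_prop)
  · filter_upwards [eventually_ge_atTop 1] with t ht
    refine ae_of_all _ fun y => ?_
    have e0 := erfc_nonneg ((|x| + |y| - γ * t) / Real.sqrt (2 * t))
    have e2 := erfc_le_two ((|x| + |y| - γ * t) / Real.sqrt (2 * t))
    have hf := first_le γ x t y ht
    have hy := abs_nonneg y
    have hn : 0 ≤ transDensity γ t x y := by unfold transDensity; positivity
    have hle : transDensity γ t x y ≤ Real.exp (γ * |x|) * Real.exp (γ * |y|) + γ / 2 := by
      unfold transDensity
      have : Real.exp (γ * (|x| + |y|) - γ ^ 2 / 2 * t) ≤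
          Real.exp (γ * |x|) * Real.exp (γ * |y|) := by
        rw [← Real.exp_add]
        refine Real.exp_le_exp.2 ?_
        have : 0 ≤ γ ^ 2 / 2 * t := by positivity
        linarith
      nlinarith
    rw [Real.norm_of_nonneg (by positivity)]
    have k1 : Real.exp (γ * |y|) * Real.exp (-2 * γ * |y|) = Real.exp (-γ * |y|) := by
      rw [← Real.exp_add]; congr 1; ring
    have k2 : Real.exp (-2 * γ * |y|) ≤ Real.exp (-γ * |y|) :=
      Real.exp_le_exp.2 (by nlinarith [mul_nonneg hγ.le hy])
    calc _ ≤ (Real.exp (γ * |x|) * Real.exp (γ * |y|) + γ / 2) * (2 * Real.exp (-2 * γ * |y|)) :=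
          mul_le_mul_of_nonneg_right hle (by positivity)
      _ = 2 * Real.exp (γ * |x|) * (Real.exp (γ * |y|) * Real.exp (-2 * γ * |y|)) +
          γ * Real.exp (-2 * γ * |y|) := by ring
      _ ≤ 2 * Real.exp (γ * |x|) * Real.exp (-γ * |y|) + γ * Real.exp (-γ * |y|) := by
          rw [k1]; gcongr
      _ = _ := by ring
  · exact ((integrable_exp_abs γ hγ).const_mul _).integrableOn
  · refine ae_of_all _ fun y => ?_
    have := (transDensity_tendsto γ x y hγ).mul_const (2 * Real.exp (-2 * γ * |y|))
    rw [show γ / 2 * (2 * Real.exp (-2 * γ * |y|)) = γ * Real.exp (-2 * γ * |y|) by ring] at this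
    exact this
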